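/- Let R be a commutative ring, f ∈ R, and let P be a monic polynomial of degree d over R[1/f]. Then for n sufficiently large, f^{nd}·P(X/f^n) has coefficients in the image of R, and lifts to a monic polynomial Q of degree d over R such that R[X]/(Q) ⊗_R R[1/f] ≅ R[1/f][X]/(P). Consequently, every standard étale R[1/f]-algebra is also (isomorphic to) a localization of a standard étale R-algebra. -/

import Mathlib

open Polynomial

/-- The standard étale style algebra `(A[X]/(P))[1/G]`. -/
abbrev StdAlg (A : Type*) [CommRing A] (P G : A[X]) : Type _ :=
  Localization.Away (Ideal.Quotient.mk (Ideal.span {P}) G)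

/-- `B` is a standard étale `A`-algebra: `B ≅ (A[X]/(P))[1/G]` with `P` monic and `P'`
invertible in the localization. -/
def IsStandardEtale (A B : Type*) [CommRing A] [CommRing B] [Algebra A B] : Prop :=
  ∃ P G : A[X], P.Monic ∧
    IsUnit (algebraMap (A[X] ⧸ Ideal.span {P}) (StdAlg A P G)
      (Ideal.Quotient.mk (Ideal.span {P}) (derivative P))) ∧
    Nonempty (B ≃ₐ[A] StdAlg A P G)

open TensorProduct

/-- A localization away from one element of a localization of `B` away from one element is
itself a localization of `B` away from one element. -/
theorem exists_algEquiv_localizationAway {R B D L : Type*} [CommRing R] [CommRing B] [CommRing D]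
    [CommRing L] [Algebra R B] [Algebra R D] [Algebra B D] [IsScalarTower R B D]
    [Algebra D L] [Algebra R L] [IsScalarTower R D L] (x : B) (g : D)
    [IsLocalization.Away x D] [IsLocalization.Away g L] :
    ∃ (b : B) (e : L ≃ₐ[R] Localization.Away b),
      ∀ y : B, e (algebraMap D L (algebraMap B D y)) = algebraMap B _ y := by
  obtain ⟨N, b, hb⟩ := IsLocalization.Away.surj x g
  let : Algebra B L := ((algebraMap D L).comp (algebraMap B D)).toAlgebra
  have : IsScalarTower B D L := .of_algebraMap_eq fun _ ↦ rfl
  have : IsScalarTower R B L := .to₁₂₄ R B D L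
  have : IsLocalization.Away (algebraMap B D b) L :=
    IsLocalization.Away.of_associated (r := g)
      (hb ▸ associated_mul_unit_right _ _ ((IsLocalization.Away.algebraMap_isUnit x).pow N))
  have : IsLocalization.Away (b * x) L := IsLocalization.Away.mul D L x b
  let e : L ≃ₐ[B] Localization.Away (b * x) :=
    IsLocalization.algEquiv (Submonoid.powers (b * x)) _ _
  exact ⟨b * x, e.restrictScalars R, e.commutes⟩

section ScaleRootsLift

variable {R S : Type*} [CommRing R] [CommRing S] [Algebra R S] {P : S[X]} {Q : R[X]}

/-- A monic polynomial over `R[1/f]` lifts to `R` after scaling its roots by a power of `f`. -/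
theorem exists_monic_map_eq_scaleRoots_pow (f : R) [IsLocalization.Away f S] (hP : P.Monic) :
    ∃ (n : ℕ) (Q : R[X]), Q.Monic ∧ Q.natDegree = P.natDegree ∧
      Q.map (algebraMap R S) = P.scaleRoots (algebraMap R S f ^ n) := by
  have hl := IsLocalization.scaleRoots_commonDenom_mem_lifts (Submonoid.powers f) P
    ⟨1, by rw [map_one, hP.leadingCoeff]⟩
  obtain ⟨n, hn⟩ := (IsLocalization.commonDenom (Submonoid.powers f) P.support P.coeff).2
  rw [← hn] at hl
  obtain ⟨Q, hQ, hd, hm⟩ :=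
    lifts_and_natDegree_eq_and_monic hl ((monic_scaleRoots_iff _).mpr hP)
  exact ⟨n, Q, hm, by rw [hd, natDegree_scaleRoots], by rw [hQ, map_pow]⟩

/-- If `Q` over `R` maps to `P.scaleRoots u` over `S`, then sending the class of `X` to `u` times
the class of `X` defines a map `R[X]/(Q) → S[X]/(P)`. -/
noncomputable def quotientScaleRootsMap (u : S) (h : Q.map (algebraMap R S) = P.scaleRoots u) :
    (R[X] ⧸ Ideal.span {Q}) →ₐ[R] S[X] ⧸ Ideal.span {P} :=
  Ideal.Quotient.liftₐ _
    (aeval (algebraMap S (S[X] ⧸ Ideal.span {P}) u * Ideal.Quotient.mk _ X)) <| by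
    suffices Ideal.span {Q} ≤ RingHom.ker
        (aeval (R := R) (algebraMap S (S[X] ⧸ Ideal.span {P}) u * Ideal.Quotient.mk _ X)) from
      fun a ha ↦ this ha
    rw [Ideal.span_singleton_le_iff_mem, RingHom.mem_ker, ← aeval_map_algebraMap S, h, aeval_def]
    refine scaleRoots_eval₂_eq_zero _ ?_
    rw [← aeval_def, ← Ideal.Quotient.mkₐ_eq_mk S, aeval_algHom_apply, aeval_X_left_apply,
      Ideal.Quotient.mkₐ_eq_mk, Ideal.Quotient.mk_singleton_self]

theorem quotientScaleRootsMap_mk (u : S) (h : Q.map (algebraMap R S) = P.scaleRoots u)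
    (g : R[X]) :
    quotientScaleRootsMap u h (Ideal.Quotient.mk _ g) =
      aeval (algebraMap S (S[X] ⧸ Ideal.span {P}) u * Ideal.Quotient.mk _ X) g :=
  rfl

theorem aeval_eq_zero_of_aeval_scaleRoots_eq_zero {T : Type*} [CommRing T] [Algebra S T] (u : Sˣ)
    (t : T) (ht : aeval (algebraMap S T u * t) (P.scaleRoots (u : S)) = 0) : aeval t P = 0 := by
  rw [aeval_def, scaleRoots_eval₂_mul, ← aeval_def] at ht
  exact ((u.isUnit.map (algebraMap S T)).pow _).mul_right_eq_zero.mp ht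

/-- If `Q` over `R` maps to `P.scaleRoots u` over `S` with `u` a unit, then sending the class of
`X` to `u⁻¹` times the class of `X` defines a map `S[X]/(P) → S ⊗[R] R[X]/(Q)`. -/
noncomputable def quotientScaleRootsInv (u : Sˣ)
    (h : Q.map (algebraMap R S) = P.scaleRoots (u : S)) :
    (S[X] ⧸ Ideal.span {P}) →ₐ[S] S ⊗[R] (R[X] ⧸ Ideal.span {Q}) :=
  Ideal.Quotient.liftₐ _
    (aeval ((↑u⁻¹ : S) ⊗ₜ[R] (Ideal.Quotient.mk (Ideal.span {Q}) X))) <| by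
    suffices Ideal.span {P} ≤ RingHom.ker
        (aeval (R := S) ((↑u⁻¹ : S) ⊗ₜ[R] (Ideal.Quotient.mk (Ideal.span {Q}) X))) from
      fun a ha ↦ this ha
    rw [Ideal.span_singleton_le_iff_mem, RingHom.mem_ker]
    refine aeval_eq_zero_of_aeval_scaleRoots_eq_zero
      (T := S ⊗[R] (R[X] ⧸ Ideal.span {Q})) u _ ?_
    rw [← h, aeval_map_algebraMap, Algebra.TensorProduct.algebraMap_apply,
      Algebra.TensorProduct.tmul_mul_tmul, Algebra.algebraMap_self_apply, Units.mul_inv, one_mul,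
      ← Algebra.TensorProduct.includeRight_apply, aeval_algHom_apply,
      ← Ideal.Quotient.mkₐ_eq_mk R, aeval_algHom_apply, aeval_X_left_apply,
      Ideal.Quotient.mkₐ_eq_mk, Ideal.Quotient.mk_singleton_self, map_zero]

theorem quotientScaleRootsInv_mk (u : Sˣ)
    (h : Q.map (algebraMap R S) = P.scaleRoots (u : S)) (g : S[X]) :
    quotientScaleRootsInv u h (Ideal.Quotient.mk _ g) =
      aeval ((↑u⁻¹ : S) ⊗ₜ[R] (Ideal.Quotient.mk (Ideal.span {Q}) X)) g :=
  rfl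

/-- If `Q` over `R` maps to `P.scaleRoots u` over `S` with `u` a unit, then `S[X]/(P)` is the base
change of `R[X]/(Q)` to `S`. -/
noncomputable def quotientScaleRootsEquiv (u : Sˣ)
    (h : Q.map (algebraMap R S) = P.scaleRoots (u : S)) :
    S ⊗[R] (R[X] ⧸ Ideal.span {Q}) ≃ₐ[S] (S[X] ⧸ Ideal.span {P}) :=
  AlgEquiv.ofAlgHom
    (Algebra.TensorProduct.lift (Algebra.ofId S _) (quotientScaleRootsMap u h)
      fun _ _ ↦ Commute.all _ _)
    (quotientScaleRootsInv u h)
    (by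
      apply Ideal.Quotient.algHom_ext
      ext
      simp [quotientScaleRootsMap_mk, quotientScaleRootsInv_mk, Algebra.ofId_apply, ← mul_assoc,
        ← map_mul])
    (by
      apply Algebra.TensorProduct.ext (by ext)
      apply Ideal.Quotient.algHom_ext
      ext
      simp [quotientScaleRootsMap_mk, quotientScaleRootsInv_mk,
        Algebra.TensorProduct.algebraMap_apply])

theorem quotientScaleRootsEquiv_one_tmul (u : Sˣ)
    (h : Q.map (algebraMap R S) = P.scaleRoots (u : S)) (b : R[X] ⧸ Ideal.span {Q}) :
    quotientScaleRootsEquiv u h (1 ⊗ₜ b) = quotientScaleRootsMap (u : S) h b := by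
  simp [quotientScaleRootsEquiv]

theorem derivative_scaleRoots_comp_C_mul_X (P : S[X]) (u : S) :
    C u * (derivative (P.scaleRoots u)).comp (C u * X) =
      C (u ^ P.natDegree) * derivative P := by
  have h : (P.scaleRoots u).comp (C u * X) = C (u ^ P.natDegree) * P := by
    rw [comp, scaleRoots_eval₂_mul, eval₂_C_X, C_pow]
  simpa [derivative_comp, -map_pow] using congrArg derivative h

theorem mul_quotientScaleRootsMap_derivative (u : S)
    (h : Q.map (algebraMap R S) = P.scaleRoots u) :
    algebraMap S (S[X] ⧸ Ideal.span {P}) u *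
        quotientScaleRootsMap u h (Ideal.Quotient.mk _ (derivative Q)) =
      algebraMap S (S[X] ⧸ Ideal.span {P}) (u ^ P.natDegree) *
        Ideal.Quotient.mk _ (derivative P) := by
  have key := congrArg (Ideal.Quotient.mkₐ S (Ideal.span {P}))
    (derivative_scaleRoots_comp_C_mul_X P u)
  rw [← h, derivative_map, comp_eq_aeval, map_mul, ← aeval_algHom_apply, map_mul, map_mul] at key
  rw [quotientScaleRootsMap_mk, ← aeval_map_algebraMap S]
  exact key

theorem isUnit_map_quotientScaleRootsMap_derivative {L : Type*} [CommRing L]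
    (τ : (S[X] ⧸ Ideal.span {P}) →+* L) (u : Sˣ)
    (h : Q.map (algebraMap R S) = P.scaleRoots (u : S))
    (hτ : IsUnit (τ (Ideal.Quotient.mk _ (derivative P)))) :
    IsUnit (τ (quotientScaleRootsMap (u : S) h (Ideal.Quotient.mk _ (derivative Q)))) := by
  apply isUnit_of_mul_isUnit_right (x := τ (algebraMap S _ u))
  rw [← map_mul, mul_quotientScaleRootsMap_derivative, map_mul]
  exact ((u.isUnit.pow _).map (τ.comp (algebraMap S _))).mul hτ

theorem isLocalizationAway_quotientScaleRootsMap (f : R) [IsLocalization.Away f S] (u : Sˣ)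
    (h : Q.map (algebraMap R S) = P.scaleRoots (u : S)) :
    letI := (quotientScaleRootsMap (u : S) h).toAlgebra
    IsLocalization.Away (algebraMap R (R[X] ⧸ Ideal.span {Q}) f) (S[X] ⧸ Ideal.span {P}) := by
  let := (quotientScaleRootsMap (u : S) h).toAlgebra
  let : Algebra (R[X] ⧸ Ideal.span {Q}) (S ⊗[R] (R[X] ⧸ Ideal.span {Q})) :=
    Algebra.TensorProduct.rightAlgebra
  have : IsLocalization.Away (algebraMap R (R[X] ⧸ Ideal.span {Q}) f)
      (S ⊗[R] (R[X] ⧸ Ideal.span {Q})) := IsLocalization.Away.tensorRight f S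
  exact IsLocalization.isLocalization_of_algEquiv (S := S ⊗[R] (R[X] ⧸ Ideal.span {Q}))
    (P := S[X] ⧸ Ideal.span {P}) _
    ({ quotientScaleRootsEquiv u h with
        commutes' := fun b ↦ quotientScaleRootsEquiv_one_tmul u h b } :
      S ⊗[R] (R[X] ⧸ Ideal.span {Q}) ≃ₐ[R[X] ⧸ Ideal.span {Q}] S[X] ⧸ Ideal.span {P})

/-- If `Q` over `R` maps to `P.scaleRoots u` over `S = R[1/f]`, with `u` a unit, then the algebra
`(S[X]/(P))[1/G]` has the form `(R[X]/(Q))[1/H]`. -/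
theorem exists_stdAlg_algEquiv (f : R) [IsLocalization.Away f S] (u : Sˣ)
    (h : Q.map (algebraMap R S) = P.scaleRoots (u : S)) (G : S[X])
    (hG : IsUnit (algebraMap (S[X] ⧸ Ideal.span {P}) (StdAlg S P G)
      (Ideal.Quotient.mk (Ideal.span {P}) (derivative P)))) :
    ∃ H : R[X],
      IsUnit (algebraMap (R[X] ⧸ Ideal.span {Q}) (StdAlg R Q H)
        (Ideal.Quotient.mk (Ideal.span {Q}) (derivative Q))) ∧
      Nonempty (StdAlg S P G ≃ₐ[R] StdAlg R Q H) := by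
  let := (quotientScaleRootsMap (u : S) h).toAlgebra
  have hf := isLocalizationAway_quotientScaleRootsMap f u h
  have : IsScalarTower R (R[X] ⧸ Ideal.span {Q}) (S[X] ⧸ Ideal.span {P}) :=
    .of_algebraMap_eq fun r ↦ ((quotientScaleRootsMap (u : S) h).commutes r).symm
  obtain ⟨b, e, he⟩ := exists_algEquiv_localizationAway (R := R) (L := StdAlg S P G)
    (algebraMap R (R[X] ⧸ Ideal.span {Q}) f) (Ideal.Quotient.mk (Ideal.span {P}) G)
  obtain ⟨H, rfl⟩ := Ideal.Quotient.mk_surjective b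
  refine ⟨H, ?_, ⟨e⟩⟩
  rw [← he]
  exact IsUnit.map e (isUnit_map_quotientScaleRootsMap_derivative _ u h hG)

end ScaleRootsLift

theorem stmt_9 {R : Type*} [CommRing R] (f : R)
    (P : Polynomial (Localization.Away f)) (hP : P.Monic) :
    (∃ (n : ℕ) (Q : R[X]), Q.Monic ∧ Q.natDegree = P.natDegree ∧
      Q.map (algebraMap R (Localization.Away f)) =
        P.scaleRoots (algebraMap R (Localization.Away f) f ^ n) ∧
      Nonempty ((Polynomial (Localization.Away f) ⧸
          Ideal.span {P}) ≃ₐ[Localization.Away f]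
        TensorProduct R (Localization.Away f) (R[X] ⧸ Ideal.span {Q}))) ∧
    (∀ (A : Type*) [CommRing A] [Algebra R A] [Algebra (Localization.Away f) A]
      [IsScalarTower R (Localization.Away f) A],
      IsStandardEtale (Localization.Away f) A →
      ∃ (Q H : R[X]), Q.Monic ∧
        IsUnit (algebraMap (R[X] ⧸ Ideal.span {Q}) (StdAlg R Q H)
          (Ideal.Quotient.mk (Ideal.span {Q}) (derivative Q))) ∧
        ∃ s : StdAlg R Q H, Nonempty (A ≃ₐ[R] Localization.Away s)) := by
  have hf : IsUnit (algebraMap R (Localization.Away f) f) :=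
    IsLocalization.Away.algebraMap_isUnit f
  constructor
  · obtain ⟨n, Q, hQ, hd, h⟩ := exists_monic_map_eq_scaleRoots_pow f hP
    exact ⟨n, Q, hQ, hd, h, ⟨(quotientScaleRootsEquiv (hf.pow n).unit h).symm⟩⟩
  · rintro A _ _ _ _ ⟨P, G, hP, hG, ⟨e⟩⟩
    obtain ⟨n, Q, hQ, -, h⟩ := exists_monic_map_eq_scaleRoots_pow f hP
    obtain ⟨H, hH, ⟨e'⟩⟩ := exists_stdAlg_algEquiv f (hf.pow n).unit h G hG
    exact ⟨Q, H, hQ, hH, 1, ⟨((e.restrictScalars R).trans e').trans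
      ((IsLocalization.atOne (StdAlg R Q H) (Localization.Away 1)).restrictScalars R)⟩⟩
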